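/- arXiv:q-alg/9510012 — 2 statements merged into one kernel-verified Lean document; each statement's English description precedes it below -/
import Mathlib

section
/- Let C be a monoidal category, X an object of C, and R : X ⊗ X → X ⊗ X a morphism satisfying the braid equation. Let R_{m,n} : X^{⊗m} ⊗ X^{⊗n} → X^{⊗n} ⊗ X^{⊗m} be the family defined from R by the hexagon recursions. For 1 ≤ i ≤ m−1 write R_i^{(m)} := id_{X^{⊗(i−1)}} ⊗ R ⊗ id_{X^{⊗(m−i−1)}} : X^{⊗m} → X^{⊗m}. Then R_{m,n} is natural with respect to these internal R's: for all 1 ≤ i ≤ m−1, R_{m,n}∘(R_i^{(m)} ⊗ id_{X^{⊗n}}) = (id_{X^{⊗n}} ⊗ R_i^{(m)})∘R_{m,n}, and for all 1 ≤ j ≤ n−1, R_{m,n}∘(id_{X^{⊗m}} ⊗ R_j^{(n)}) = (R_j^{(n)} ⊗ id_{X^{⊗m}})∘R_{m,n} (suppressing associators). -/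
open CategoryTheory MonoidalCategory

variable {C : Type*} [Category C] [MonoidalCategory C]

/-- Iterated tensor power `X^{⊗n}` (new factor on the left). -/
def pw (X : C) : ℕ → C
  | 0 => 𝟙_ C
  | n + 1 => X ⊗ pw X n

/-- Canonical identification `X^{⊗a} ⊗ X^{⊗b} ⟶ X^{⊗(b+a)}`. -/
def pwAdd (X : C) : (a b : ℕ) → (pw X a ⊗ pw X b ⟶ pw X (b + a))
  | 0, b => (λ_ (pw X b)).hom
  | a + 1, b => (α_ X (pw X a) (pw X b)).hom ≫ (X ◁ pwAdd X a b)

/-- Canonical identification `X^{⊗a} ⊗ X^{⊗b} ⟶ X^{⊗(a+b)}`. -/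
def pwAdd' (X : C) (a b : ℕ) : pw X a ⊗ pw X b ⟶ pw X (a + b) :=
  pwAdd X a b ≫ eqToHom (by rw [Nat.add_comm])

/-- The family `R_{1,n}` defined by the hexagon recursion
`R_{1,n+1} := (id_X ⊗ R_{1,n}) ∘ (R ⊗ id_{X^{⊗n}})`. -/
def R1 (X : C) (R : X ⊗ X ⟶ X ⊗ X) : (n : ℕ) → (X ⊗ pw X n ⟶ pw X n ⊗ X)
  | 0 => (ρ_ X).hom ≫ (λ_ X).inv
  | n + 1 => (α_ X X (pw X n)).inv ≫ (R ▷ pw X n) ≫ (α_ X X (pw X n)).hom ≫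
      (X ◁ R1 X R n) ≫ (α_ X (pw X n) X).inv

/-- The family `R_{m,n}` defined by the hexagon recursion
`R_{m+1,n} := (R_{1,n} ⊗ id_{X^{⊗m}}) ∘ (id_X ⊗ R_{m,n})`. -/
def Rmn (X : C) (R : X ⊗ X ⟶ X ⊗ X) : (m n : ℕ) → (pw X m ⊗ pw X n ⟶ pw X n ⊗ pw X m)
  | 0, n => (λ_ (pw X n)).hom ≫ (ρ_ (pw X n)).inv
  | m + 1, n => (α_ X (pw X m) (pw X n)).hom ≫ (X ◁ Rmn X R m n) ≫
      (α_ X (pw X n) (pw X m)).inv ≫ (R1 X R n ▷ pw X m) ≫ (α_ (pw X n) X (pw X m)).hom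


/-- The internal morphism `R_i^{(m)} := id_{X^{⊗(i-1)}} ⊗ R ⊗ id_{X^{⊗(m-i-1)}}` acting at
position `i` of `X^{⊗m}` (for `1 ≤ i ≤ m-1`; the identity in the degenerate cases). -/
def Rint (X : C) (R : X ⊗ X ⟶ X ⊗ X) : (i m : ℕ) → (pw X m ⟶ pw X m)
  | _, 0 => 𝟙 (pw X 0)
  | _, 1 => 𝟙 (pw X 1)
  | 0, m + 2 => 𝟙 (pw X (m + 2))
  | 1, m + 2 => (α_ X X (pw X m)).inv ≫ (R ▷ pw X m) ≫ (α_ X X (pw X m)).hom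
  | i + 2, m + 2 => X ◁ Rint X R (i + 1) (m + 1)

/-- The braid equation. -/
def BraidEq (X : C) (R : X ⊗ X ⟶ X ⊗ X) : Prop :=
  (X ◁ R) ≫ (α_ X X X).inv ≫ (R ▷ X) ≫ (α_ X X X).hom ≫ (X ◁ R)
      = (α_ X X X).inv ≫ (R ▷ X) ≫ (α_ X X X).hom ≫ (X ◁ R) ≫
        (α_ X X X).inv ≫ (R ▷ X) ≫ (α_ X X X).hom

theorem stepA1 (X P : C) (R : X ⊗ X ⟶ X ⊗ X) (h : BraidEq X R) (r : X ⊗ P ⟶ P ⊗ X) :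
    X ◁ ((α_ X X P).inv ≫ (R ▷ P) ≫ (α_ X X P).hom) ≫ (α_ X X (X ⊗ P)).inv ≫ (R ▷ (X ⊗ P)) ≫
      (α_ X X (X ⊗ P)).hom ≫ (X ◁ ((α_ X X P).inv ≫ (R ▷ P) ≫ (α_ X X P).hom ≫
      (X ◁ r) ≫ (α_ X P X).inv)) ≫ (α_ X (X ⊗ P) X).inv =
    ((α_ X X (X ⊗ P)).inv ≫ (R ▷ (X ⊗ P)) ≫
      (α_ X X (X ⊗ P)).hom ≫ (X ◁ ((α_ X X P).inv ≫ (R ▷ P) ≫ (α_ X X P).hom ≫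
      (X ◁ r) ≫ (α_ X P X).inv)) ≫ (α_ X (X ⊗ P) X).inv) ≫
      ((α_ X X P).inv ≫ (R ▷ P) ≫ (α_ X X P).hom) ▷ X := by
  unfold BraidEq at h
  calc _ = 𝟙 _ ⊗≫ ((X ◁ R) ≫ (α_ X X X).inv ≫ (R ▷ X) ≫ (α_ X X X).hom ≫ (X ◁ R)) ▷ P ⊗≫
        X ◁ X ◁ r ⊗≫ 𝟙 _ := by monoidal
    _ = 𝟙 _ ⊗≫ R ▷ X ▷ P ⊗≫ X ◁ R ▷ P ⊗≫ (R ▷ (X ⊗ P) ≫ (X ⊗ X) ◁ r) ⊗≫ 𝟙 _ := by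
        rw [h]; monoidal
    _ = _ := by rw [← whisker_exchange]; monoidal

theorem stepA2 (X P : C) (R : X ⊗ X ⟶ X ⊗ X) (r : X ⊗ P ⟶ P ⊗ X) (f : P ⟶ P)
    (ih : X ◁ f ≫ r = r ≫ f ▷ X) :
    X ◁ X ◁ f ≫ (α_ X X P).inv ≫ (R ▷ P) ≫ (α_ X X P).hom ≫ (X ◁ r) ≫ (α_ X P X).inv =
    ((α_ X X P).inv ≫ (R ▷ P) ≫ (α_ X X P).hom ≫ (X ◁ r) ≫ (α_ X P X).inv) ≫ (X ◁ f) ▷ X := by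
  calc _ = 𝟙 _ ⊗≫ ((X ⊗ X) ◁ f ≫ R ▷ P) ⊗≫ X ◁ r ⊗≫ 𝟙 _ := by monoidal
    _ = 𝟙 _ ⊗≫ R ▷ P ⊗≫ X ◁ (X ◁ f ≫ r) ⊗≫ 𝟙 _ := by rw [whisker_exchange]; monoidal
    _ = _ := by rw [ih]; monoidal

theorem R1_nat (X : C) (R : X ⊗ X ⟶ X ⊗ X) (h : BraidEq X R) (n j : ℕ) :
    X ◁ Rint X R j n ≫ R1 X R n = R1 X R n ≫ Rint X R j n ▷ X := by
  induction n generalizing j with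
  | zero => simp [Rint]
  | succ n ih =>
    match n, j with
    | 0, j => simp [Rint]
    | n + 1, 0 => simp [Rint]
    | n + 1, 1 => exact stepA1 X (pw X n) R h (R1 X R n)
    | n + 1, j + 2 => exact stepA2 X (pw X (n + 1)) R (R1 X R (n + 1)) _ (ih (j + 1))

theorem stepB (X P : C) (R : X ⊗ X ⟶ X ⊗ X) (h : BraidEq X R) (r : X ⊗ P ⟶ P ⊗ X)
    (ih : R ▷ P ≫ (α_ X X P).hom ≫ X ◁ r ≫ (α_ X P X).inv ≫ r ▷ X ≫ (α_ P X X).hom =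
      (α_ X X P).hom ≫ X ◁ r ≫ (α_ X P X).inv ≫ r ▷ X ≫ (α_ P X X).hom ≫ P ◁ R)
    (s : X ⊗ (X ⊗ P) ⟶ (X ⊗ P) ⊗ X)
    (hs : s = (α_ X X P).inv ≫ (R ▷ P) ≫ (α_ X X P).hom ≫ (X ◁ r) ≫ (α_ X P X).inv) :
    R ▷ (X ⊗ P) ≫ (α_ X X (X ⊗ P)).hom ≫ X ◁ s ≫ (α_ X (X ⊗ P) X).inv ≫ s ▷ X ≫
        (α_ (X ⊗ P) X X).hom =
      (α_ X X (X ⊗ P)).hom ≫ X ◁ s ≫ (α_ X (X ⊗ P) X).inv ≫ s ▷ X ≫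
        (α_ (X ⊗ P) X X).hom ≫ (X ⊗ P) ◁ R := by
  unfold BraidEq at h
  subst hs
  calc _ = 𝟙 _ ⊗≫ R ▷ X ▷ P ⊗≫ X ◁ R ▷ P ⊗≫ ((X ⊗ X) ◁ r ≫ R ▷ (P ⊗ X)) ⊗≫
        X ◁ r ▷ X ⊗≫ 𝟙 _ := by monoidal
    _ = 𝟙 _ ⊗≫ ((α_ X X X).inv ≫ (R ▷ X) ≫ (α_ X X X).hom ≫ (X ◁ R) ≫
        (α_ X X X).inv ≫ (R ▷ X) ≫ (α_ X X X).hom) ▷ P ⊗≫ X ◁ X ◁ r ⊗≫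
        X ◁ r ▷ X ⊗≫ 𝟙 _ := by rw [whisker_exchange]; monoidal
    _ = 𝟙 _ ⊗≫ X ◁ R ▷ P ⊗≫ R ▷ X ▷ P ⊗≫ X ◁ (R ▷ P ≫ (α_ X X P).hom ≫ X ◁ r ≫
        (α_ X P X).inv ≫ r ▷ X ≫ (α_ P X X).hom) ⊗≫ 𝟙 _ := by rw [← h]; monoidal
    _ = 𝟙 _ ⊗≫ X ◁ R ▷ P ⊗≫ (R ▷ (X ⊗ P) ≫ (X ⊗ X) ◁ r) ⊗≫ X ◁ r ▷ X ⊗≫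
        X ◁ P ◁ R ⊗≫ 𝟙 _ := by rw [ih]; monoidal
    _ = _ := by rw [← whisker_exchange]; monoidal

theorem R1_two (X : C) (R : X ⊗ X ⟶ X ⊗ X) (h : BraidEq X R) (n : ℕ) :
    R ▷ pw X n ≫ (α_ X X (pw X n)).hom ≫ X ◁ R1 X R n ≫ (α_ X (pw X n) X).inv ≫
        R1 X R n ▷ X ≫ (α_ (pw X n) X X).hom =
      (α_ X X (pw X n)).hom ≫ X ◁ R1 X R n ≫ (α_ X (pw X n) X).inv ≫
        R1 X R n ▷ X ≫ (α_ (pw X n) X X).hom ≫ pw X n ◁ R := by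
  induction n with
  | zero => simp only [R1, pw]; monoidal
  | succ n ih => exact stepB X (pw X n) R h (R1 X R n) ih _ rfl

theorem stepC (X P Q : C) (R : X ⊗ X ⟶ X ⊗ X) (r : X ⊗ P ⟶ P ⊗ X) (t : Q ⊗ P ⟶ P ⊗ Q)
    (ih : R ▷ P ≫ (α_ X X P).hom ≫ X ◁ r ≫ (α_ X P X).inv ≫ r ▷ X ≫ (α_ P X X).hom =
      (α_ X X P).hom ≫ X ◁ r ≫ (α_ X P X).inv ≫ r ▷ X ≫ (α_ P X X).hom ≫ P ◁ R)
    (u : (X ⊗ X ⊗ Q) ⊗ P ⟶ P ⊗ X ⊗ X ⊗ Q)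
    (hu : u = (α_ X (X ⊗ Q) P).hom ≫ X ◁ ((α_ X Q P).hom ≫ X ◁ t ≫ (α_ X P Q).inv ≫ r ▷ Q ≫
      (α_ P X Q).hom) ≫ (α_ X P (X ⊗ Q)).inv ≫ r ▷ (X ⊗ Q) ≫ (α_ P X (X ⊗ Q)).hom) :
    ((α_ X X Q).inv ≫ R ▷ Q ≫ (α_ X X Q).hom) ▷ P ≫ u =
      u ≫ P ◁ ((α_ X X Q).inv ≫ R ▷ Q ≫ (α_ X X Q).hom) := by
  subst hu
  calc _ = 𝟙 _ ⊗≫ (R ▷ (Q ⊗ P) ≫ (X ⊗ X) ◁ t) ⊗≫ X ◁ r ▷ Q ⊗≫ r ▷ X ▷ Q ⊗≫ 𝟙 _ := by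
        monoidal
    _ = 𝟙 _ ⊗≫ X ◁ X ◁ t ⊗≫ (R ▷ P ≫ (α_ X X P).hom ≫ X ◁ r ≫ (α_ X P X).inv ≫ r ▷ X ≫
        (α_ P X X).hom) ▷ Q ⊗≫ 𝟙 _ := by rw [← whisker_exchange]; monoidal
    _ = _ := by rw [ih]; monoidal

theorem stepD (X P Q : C) (r : X ⊗ P ⟶ P ⊗ X) (t : Q ⊗ P ⟶ P ⊗ Q) (f : Q ⟶ Q)
    (ih : f ▷ P ≫ t = t ≫ P ◁ f) :
    (X ◁ f) ▷ P ≫ (α_ X Q P).hom ≫ X ◁ t ≫ (α_ X P Q).inv ≫ r ▷ Q ≫ (α_ P X Q).hom =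
    ((α_ X Q P).hom ≫ X ◁ t ≫ (α_ X P Q).inv ≫ r ▷ Q ≫ (α_ P X Q).hom) ≫ P ◁ X ◁ f := by
  calc _ = 𝟙 _ ⊗≫ X ◁ (f ▷ P ≫ t) ⊗≫ r ▷ Q ⊗≫ 𝟙 _ := by monoidal
    _ = 𝟙 _ ⊗≫ X ◁ t ⊗≫ ((X ⊗ P) ◁ f ≫ r ▷ Q) ⊗≫ 𝟙 _ := by rw [ih]; monoidal
    _ = _ := by rw [whisker_exchange]; monoidal

theorem stepE (X P Q : C) (r : X ⊗ P ⟶ P ⊗ X) (t : Q ⊗ P ⟶ P ⊗ Q) (f : P ⟶ P)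
    (hr : X ◁ f ≫ r = r ≫ f ▷ X) (ih : Q ◁ f ≫ t = t ≫ f ▷ Q) :
    (X ⊗ Q) ◁ f ≫ (α_ X Q P).hom ≫ X ◁ t ≫ (α_ X P Q).inv ≫ r ▷ Q ≫ (α_ P X Q).hom =
    ((α_ X Q P).hom ≫ X ◁ t ≫ (α_ X P Q).inv ≫ r ▷ Q ≫ (α_ P X Q).hom) ≫ f ▷ (X ⊗ Q) := by
  calc _ = 𝟙 _ ⊗≫ X ◁ (Q ◁ f ≫ t) ⊗≫ r ▷ Q ⊗≫ 𝟙 _ := by monoidal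
    _ = 𝟙 _ ⊗≫ X ◁ t ⊗≫ (X ◁ f ≫ r) ▷ Q ⊗≫ 𝟙 _ := by rw [ih]; monoidal
    _ = _ := by rw [hr]; monoidal

theorem Rmn_left (X : C) (R : X ⊗ X ⟶ X ⊗ X) (h : BraidEq X R) (n m i : ℕ) :
    Rint X R i m ▷ pw X n ≫ Rmn X R m n = Rmn X R m n ≫ pw X n ◁ Rint X R i m := by
  induction m generalizing i with
  | zero => simp [Rint]
  | succ m ih =>
    match m, i with
    | 0, i => simp [Rint]
    | m + 1, 0 => simp [Rint]
    | m + 1, 1 =>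
      exact stepC X (pw X n) (pw X m) R (R1 X R n) (Rmn X R m n) (R1_two X R h n) _ rfl
    | m + 1, i + 2 =>
      exact stepD X (pw X n) (pw X (m + 1)) (R1 X R n) (Rmn X R (m + 1) n) _ (ih (i + 1))

theorem Rmn_right (X : C) (R : X ⊗ X ⟶ X ⊗ X) (h : BraidEq X R) (n m j : ℕ) :
    pw X m ◁ Rint X R j n ≫ Rmn X R m n = Rmn X R m n ≫ Rint X R j n ▷ pw X m := by
  induction m with
  | zero => simp only [Rmn, pw]; monoidal
  | succ m ih =>
    exact stepE X (pw X n) (pw X m) (R1 X R n) (Rmn X R m n) _ (R1_nat X R h n j) ih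

/-- `R_{m,n}` is natural with respect to the internal morphisms `R_i^{(m)}`. -/
theorem stmt10 (X : C) (R : X ⊗ X ⟶ X ⊗ X)
    (hbraid : (X ◁ R) ≫ (α_ X X X).inv ≫ (R ▷ X) ≫ (α_ X X X).hom ≫ (X ◁ R)
      = (α_ X X X).inv ≫ (R ▷ X) ≫ (α_ X X X).hom ≫ (X ◁ R) ≫
        (α_ X X X).inv ≫ (R ▷ X) ≫ (α_ X X X).hom) :
    (∀ m n i : ℕ, 1 ≤ i → i ≤ m - 1 →
      (Rint X R i m ▷ pw X n) ≫ Rmn X R m n = Rmn X R m n ≫ (pw X n ◁ Rint X R i m)) ∧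
    (∀ m n j : ℕ, 1 ≤ j → j ≤ n - 1 →
      (pw X m ◁ Rint X R j n) ≫ Rmn X R m n = Rmn X R m n ≫ (Rint X R j n ▷ pw X m)) := by
  exact ⟨fun m n i _ _ => Rmn_left X R hbraid n m i,
    fun m n j _ _ => Rmn_right X R hbraid n m j⟩
end

section
/- Let B_n be the braid group on n strands, presented by generators σ_1, …, σ_{n−1} and the braid relations, let S_n be the symmetric group on n letters, and let π : B_n → S_n be the canonical homomorphism sending σ_i to the adjacent transposition s_i = (i, i+1). For w ∈ S_n let ℓ(w) denote the minimal length of an expression of w as a product of adjacent transpositions. Then there exists a unique function ŝ : S_n → B_n such that ŝ(s_i) = σ_i for every 1 ≤ i ≤ n−1 and ŝ(uv) = ŝ(u)ŝ(v) whenever ℓ(uv) = ℓ(u) + ℓ(v); moreover ŝ is a section of π, i.e., π∘ŝ = id_{S_n}. -/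
/-- The braid relations on `m` generators `σ_1, …, σ_m`. -/
def braidRels (m : ℕ) : Set (FreeGroup (Fin m)) :=
  {r | (∃ i j : Fin m, (i : ℕ) + 1 = (j : ℕ) ∧
          r = FreeGroup.of i * FreeGroup.of j * FreeGroup.of i *
              (FreeGroup.of j * FreeGroup.of i * FreeGroup.of j)⁻¹) ∨
       (∃ i j : Fin m, ((i : ℕ) + 2 ≤ (j : ℕ) ∨ (j : ℕ) + 2 ≤ (i : ℕ)) ∧
          r = FreeGroup.of i * FreeGroup.of j * (FreeGroup.of j * FreeGroup.of i)⁻¹)}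

/-- The adjacent transposition `s_i = (i, i+1)` in the symmetric group on `Fin n`. -/
def adjT (n : ℕ) (i : Fin (n - 1)) : Equiv.Perm (Fin n) :=
  Equiv.swap ⟨(i : ℕ), by have := i.isLt; omega⟩ ⟨(i : ℕ) + 1, by have := i.isLt; omega⟩

/-- The length `ℓ(w)`: the minimal number of adjacent transpositions in an expression of
`w` as their product. -/
noncomputable def permLength (n : ℕ) (w : Equiv.Perm (Fin n)) : ℕ :=
  sInf {k | ∃ l : List (Fin (n - 1)), l.length = k ∧ (l.map (adjT n)).prod = w}

namespace Matsu

def lo (n : ℕ) (i : Fin (n - 1)) : Fin n := ⟨(i : ℕ), by have := i.isLt; omega⟩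
def hi (n : ℕ) (i : Fin (n - 1)) : Fin n := ⟨(i : ℕ) + 1, by have := i.isLt; omega⟩

lemma adjT_eq (n : ℕ) (i : Fin (n - 1)) : adjT n i = Equiv.swap (lo n i) (hi n i) := rfl

lemma lo_lt_hi (n : ℕ) (i : Fin (n - 1)) : lo n i < hi n i := by
  simp [lo, hi, Fin.lt_def]

lemma adjT_lo (n : ℕ) (i : Fin (n - 1)) : adjT n i (lo n i) = hi n i := by
  simp [adjT_eq]

lemma adjT_hi (n : ℕ) (i : Fin (n - 1)) : adjT n i (hi n i) = lo n i := by
  simp [adjT_eq]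

lemma adjT_of_ne (n : ℕ) (i : Fin (n - 1)) {x : Fin n} (h1 : x ≠ lo n i) (h2 : x ≠ hi n i) :
    adjT n i x = x := by
  rw [adjT_eq, Equiv.swap_apply_of_ne_of_ne h1 h2]

lemma adjT_sq (n : ℕ) (i : Fin (n - 1)) : adjT n i * adjT n i = 1 := by
  simp [adjT_eq]

lemma adjT_adjT (n : ℕ) (i : Fin (n - 1)) (x : Fin n) : adjT n i (adjT n i x) = x := by
  simp [adjT_eq]

/-- the simple transposition preserves the order of all pairs but one -/
lemma adjT_lt (n : ℕ) (i : Fin (n - 1)) {a b : Fin n} (h : a < b)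
    (hne : ¬ (a = lo n i ∧ b = hi n i)) : adjT n i a < adjT n i b := by
  have hlo : (lo n i : ℕ) = i := rfl
  have hhi : (hi n i : ℕ) = i + 1 := rfl
  rw [adjT_eq, Equiv.swap_apply_def, Equiv.swap_apply_def]
  simp only [Fin.ext_iff, Fin.lt_def] at *
  split_ifs <;> omega

def invs (n : ℕ) (w : Equiv.Perm (Fin n)) : Finset (Fin n × Fin n) :=
  Finset.univ.filter fun p => p.1 < p.2 ∧ w p.2 < w p.1

def inv (n : ℕ) (w : Equiv.Perm (Fin n)) : ℕ := (invs n w).card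

lemma mem_invs (n : ℕ) (w : Equiv.Perm (Fin n)) (p : Fin n × Fin n) :
    p ∈ invs n w ↔ p.1 < p.2 ∧ w p.2 < w p.1 := by
  simp [invs]

lemma inv_asc (n : ℕ) (w : Equiv.Perm (Fin n)) (i : Fin (n - 1))
    (h : w (lo n i) < w (hi n i)) : inv n (w * adjT n i) = inv n w + 1 := by
  classical
  have key : invs n (w * adjT n i) =
      insert (lo n i, hi n i)
        ((invs n w).map ((adjT n i).prodCongr (adjT n i)).toEmbedding) := by
    ext ⟨a, b⟩
    simp only [mem_invs, Finset.mem_insert, Finset.mem_map, Equiv.Perm.mul_apply, Prod.mk.injEq, Equiv.coe_toEmbedding,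
      Equiv.prodCongr_apply, Prod.map, Prod.exists]
    constructor
    · rintro ⟨h1, h2⟩
      by_cases hc : a = lo n i ∧ b = hi n i
      · exact Or.inl hc
      · refine Or.inr ⟨adjT n i a, adjT n i b, ⟨adjT_lt n i h1 hc, h2⟩, ?_, ?_⟩ <;>
          exact adjT_adjT _ _ _
    · rintro (⟨rfl, rfl⟩ | ⟨c, d, ⟨h1, h2⟩, rfl, rfl⟩)
      · rw [adjT_lo, adjT_hi]
        exact ⟨lo_lt_hi n i, h⟩
      · rw [adjT_adjT, adjT_adjT]
        refine ⟨adjT_lt n i h1 ?_, h2⟩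
        rintro ⟨rfl, rfl⟩
        exact absurd h (not_lt.mpr h2.le)
  rw [inv, key, Finset.card_insert_of_notMem, Finset.card_map, inv]
  simp only [invs, Finset.mem_map, Finset.mem_filter, Finset.mem_univ,
      true_and, Prod.mk.injEq, Equiv.coe_toEmbedding,
      Equiv.prodCongr_apply, Prod.map, Prod.exists]
  rintro ⟨c, d, ⟨h1, h2⟩, h3, h4⟩
  have hc : c = hi n i := by rw [← adjT_adjT n i c, h3, adjT_lo]
  have hd : d = lo n i := by rw [← adjT_adjT n i d, h4, adjT_hi]
  subst hc hd
  exact absurd h1 (not_lt.mpr (lo_lt_hi n i).le)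

lemma mul_adjT_cancel (n : ℕ) (w : Equiv.Perm (Fin n)) (i : Fin (n - 1)) :
    w * adjT n i * adjT n i = w := by
  rw [mul_assoc, adjT_sq, mul_one]

lemma inv_desc (n : ℕ) (w : Equiv.Perm (Fin n)) (i : Fin (n - 1))
    (h : w (hi n i) < w (lo n i)) : inv n w = inv n (w * adjT n i) + 1 := by
  have := inv_asc n (w * adjT n i) i (by
    simpa only [Equiv.Perm.mul_apply, adjT_lo, adjT_hi] using h)
  rwa [mul_adjT_cancel] at this

lemma asc_or_desc (n : ℕ) (w : Equiv.Perm (Fin n)) (i : Fin (n - 1)) :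
    w (lo n i) < w (hi n i) ∨ w (hi n i) < w (lo n i) :=
  lt_or_gt_of_ne fun h => (lo_lt_hi n i).ne (w.injective h)

lemma exists_desc (n : ℕ) (w : Equiv.Perm (Fin n)) (hw : w ≠ 1) :
    ∃ i, w (hi n i) < w (lo n i) := by
  by_contra hcon
  push Not at hcon
  apply hw
  have hm : StrictMono w := by
    cases n with
    | zero => intro a; exact a.elim0
    | succ m =>
      rw [Fin.strictMono_iff_lt_succ]
      intro i
      rcases asc_or_desc (m + 1) w i with h | h
      · exact h
      · exact absurd h (not_lt.mpr (hcon i))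
  have := Subsingleton.elim (StrictMono.orderIsoOfSurjective w hm w.surjective) (OrderIso.refl _)
  ext x
  exact congrArg Fin.val (DFunLike.congr_fun this x)

lemma inv_one (n : ℕ) : inv n 1 = 0 := by
  rw [inv, Finset.card_eq_zero, invs, Finset.filter_eq_empty_iff]
  rintro ⟨a, b⟩ - ⟨h1, h2⟩
  exact absurd h1 (not_lt.mpr h2.le)

lemma inv_mul_le (n : ℕ) (w : Equiv.Perm (Fin n)) (i : Fin (n - 1)) :
    inv n (w * adjT n i) ≤ inv n w + 1 := by
  rcases asc_or_desc n w i with h | h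
  · exact (inv_asc n w i h).le
  · have := inv_desc n w i h
    omega

lemma inv_word_le (n : ℕ) (l : List (Fin (n - 1))) :
    inv n (l.map (adjT n)).prod ≤ l.length := by
  induction l using List.reverseRecOn with
  | nil => simp [inv_one]
  | append_singleton l i ih =>
    simp only [List.map_append, List.prod_append, List.map_cons, List.map_nil, List.prod_cons,
      List.prod_nil, mul_one, List.length_append, List.length_cons, List.length_nil]
    have := inv_mul_le n (l.map (adjT n)).prod i
    omega

lemma exists_word (n : ℕ) : ∀ (k : ℕ) (w : Equiv.Perm (Fin n)), inv n w = k →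
    ∃ l : List (Fin (n - 1)), l.length = k ∧ (l.map (adjT n)).prod = w := by
  intro k
  induction k with
  | zero =>
    intro w hw
    by_cases h1 : w = 1
    · exact ⟨[], rfl, by simp [h1]⟩
    · obtain ⟨i, hi⟩ := exists_desc n w h1
      have := inv_desc n w i hi
      omega
  | succ k ih =>
    intro w hw
    have h1 : w ≠ 1 := by
      rintro rfl
      rw [inv_one] at hw
      omega
    obtain ⟨i, hi⟩ := exists_desc n w h1
    have := inv_desc n w i hi
    obtain ⟨l, hl, hp⟩ := ih (w * adjT n i) (by omega)
    refine ⟨l ++ [i], by simp [hl], ?_⟩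
    simp [hp, mul_adjT_cancel]

lemma permLength_eq (n : ℕ) (w : Equiv.Perm (Fin n)) : permLength n w = inv n w := by
  apply le_antisymm
  · exact Nat.sInf_le (exists_word n _ w rfl)
  · obtain ⟨l, hl, hp⟩ := Nat.sInf_mem
      (s := {k | ∃ l : List (Fin (n - 1)), l.length = k ∧ (l.map (adjT n)).prod = w})
      ⟨_, exists_word n _ w rfl⟩
    rw [permLength, ← hl, ← hp]
    exact inv_word_le n l

lemma inv_mul_le_add (n : ℕ) (u v : Equiv.Perm (Fin n)) :
    inv n (u * v) ≤ inv n u + inv n v := by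
  obtain ⟨l, hl, hp⟩ := exists_word n _ u rfl
  obtain ⟨l', hl', hp'⟩ := exists_word n _ v rfl
  have := inv_word_le n (l ++ l')
  rw [List.map_append, List.prod_append, hp, hp', List.length_append, hl, hl'] at this
  exact this

abbrev B (n : ℕ) := PresentedGroup (braidRels (n - 1))

def sg (n : ℕ) (i : Fin (n - 1)) : B n := PresentedGroup.of i

lemma sg_braid (n : ℕ) (i j : Fin (n - 1)) (h : (i : ℕ) + 1 = j) :
    sg n i * sg n j * sg n i = sg n j * sg n i * sg n j := by
  have := PresentedGroup.one_of_mem (rels := braidRels (n - 1)) (Or.inl ⟨i, j, h, rfl⟩)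
  simp only [map_mul, map_inv] at this
  exact mul_inv_eq_one.mp this

lemma sg_comm (n : ℕ) (i j : Fin (n - 1)) (h : (i : ℕ) + 2 ≤ j ∨ (j : ℕ) + 2 ≤ i) :
    sg n i * sg n j = sg n j * sg n i := by
  have := PresentedGroup.one_of_mem (rels := braidRels (n - 1)) (Or.inr ⟨i, j, h, rfl⟩)
  simp only [map_mul, map_inv] at this
  exact mul_inv_eq_one.mp this

/-- `b` is the braid of some reduced word of `w` -/
inductive R (n : ℕ) : Equiv.Perm (Fin n) → B n → Prop
  | one : R n 1 1
  | step (w : Equiv.Perm (Fin n)) (b : B n) (i : Fin (n - 1)) (h : w (lo n i) < w (hi n i))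
      (hr : R n w b) : R n (w * adjT n i) (b * sg n i)

lemma R_desc (n : ℕ) {w : Equiv.Perm (Fin n)} {b : B n} (i : Fin (n - 1))
    (h : w (hi n i) < w (lo n i)) (hr : R n (w * adjT n i) b) : R n w (b * sg n i) := by
  have := R.step (w * adjT n i) b i (by
    simpa only [Equiv.Perm.mul_apply, adjT_lo, adjT_hi] using h) hr
  rwa [mul_adjT_cancel] at this

lemma R_exists (n : ℕ) : ∀ (k : ℕ) (w : Equiv.Perm (Fin n)), inv n w = k → ∃ b, R n w b := by
  intro k
  induction k with
  | zero =>
    intro w hw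
    by_cases h1 : w = 1
    · exact ⟨1, h1 ▸ R.one⟩
    · obtain ⟨i, hi⟩ := exists_desc n w h1
      have := inv_desc n w i hi
      omega
  | succ k ih =>
    intro w hw
    have h1 : w ≠ 1 := by
      rintro rfl
      rw [inv_one] at hw
      omega
    obtain ⟨i, hi⟩ := exists_desc n w h1
    have := inv_desc n w i hi
    obtain ⟨b, hb⟩ := ih (w * adjT n i) (by omega)
    exact ⟨_, R_desc n i hi hb⟩

lemma R_inv (n : ℕ) {w : Equiv.Perm (Fin n)} {b : B n} (hr : R n w b) :
    (w = 1 ∧ b = 1) ∨ ∃ i c, w (hi n i) < w (lo n i) ∧ R n (w * adjT n i) c ∧ b = c * sg n i := by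
  cases hr with
  | one => exact Or.inl ⟨rfl, rfl⟩
  | step w b i h hr =>
    refine Or.inr ⟨i, b, ?_, ?_, rfl⟩
    · simpa only [Equiv.Perm.mul_apply, adjT_lo, adjT_hi] using h
    · rwa [mul_adjT_cancel]

/-- far apart case -/
lemma far (n : ℕ) (w : Equiv.Perm (Fin n))
    (ih : ∀ w', inv n w' < inv n w → ∀ b b', R n w' b → R n w' b' → b = b')
    (i j : Fin (n - 1)) (hij : (i : ℕ) + 2 ≤ j ∨ (j : ℕ) + 2 ≤ i)
    (hi' : w (hi n i) < w (lo n i)) (hj' : w (hi n j) < w (lo n j)) (c c' : B n)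
    (hc : R n (w * adjT n i) c) (hc' : R n (w * adjT n j) c') :
    c * sg n i = c' * sg n j := by
  have e1 : adjT n i (lo n j) = lo n j := adjT_of_ne _ _
    (by simp only [lo, ne_eq, Fin.mk.injEq]; omega)
    (by simp only [lo, hi, ne_eq, Fin.mk.injEq]; omega)
  have e2 : adjT n i (hi n j) = hi n j := adjT_of_ne _ _
    (by simp only [lo, hi, ne_eq, Fin.mk.injEq]; omega)
    (by simp only [hi, ne_eq, Fin.mk.injEq]; omega)
  have e3 : adjT n j (lo n i) = lo n i := adjT_of_ne _ _
    (by simp only [lo, ne_eq, Fin.mk.injEq]; omega)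
    (by simp only [lo, hi, ne_eq, Fin.mk.injEq]; omega)
  have e4 : adjT n j (hi n i) = hi n i := adjT_of_ne _ _
    (by simp only [lo, hi, ne_eq, Fin.mk.injEq]; omega)
    (by simp only [hi, ne_eq, Fin.mk.injEq]; omega)
  have hcomm : adjT n i * adjT n j = adjT n j * adjT n i := by
    have : adjT n i * adjT n j * (adjT n i)⁻¹ = adjT n j := by
      conv_lhs => rw [adjT_eq n j]
      rw [← Equiv.swap_apply_apply, e1, e2, adjT_eq]
    exact mul_inv_eq_iff_eq_mul.mp this
  obtain ⟨d, hd⟩ := R_exists n _ (w * adjT n i * adjT n j) rfl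
  have h1 : R n (w * adjT n i) (d * sg n j) := R_desc n j (by
    simpa only [Equiv.Perm.mul_apply, e1, e2] using hj') hd
  rw [mul_assoc, hcomm, ← mul_assoc] at hd
  have h2 : R n (w * adjT n j) (d * sg n i) := R_desc n i (by
    simpa only [Equiv.Perm.mul_apply, e3, e4] using hi') hd
  have d1 := inv_desc n w i hi'
  have d2 := inv_desc n w j hj'
  rw [ih _ (by omega) _ _ hc h1, ih _ (by omega) _ _ hc' h2, mul_assoc, mul_assoc,
    sg_comm n i j hij]

/-- adjacent case -/
lemma near (n : ℕ) (w : Equiv.Perm (Fin n))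
    (ih : ∀ w', inv n w' < inv n w → ∀ b b', R n w' b → R n w' b' → b = b')
    (i j : Fin (n - 1)) (hij : (i : ℕ) + 1 = j)
    (hi' : w (hi n i) < w (lo n i)) (hj' : w (hi n j) < w (lo n j)) (c c' : B n)
    (hc : R n (w * adjT n i) c) (hc' : R n (w * adjT n j) c') :
    c * sg n i = c' * sg n j := by
  have e0 : hi n i = lo n j := by simp only [lo, hi, Fin.mk.injEq]; omega
  have e2 : adjT n i (hi n j) = hi n j := adjT_of_ne _ _
    (by simp only [lo, hi, ne_eq, Fin.mk.injEq]; omega)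
    (by simp only [hi, ne_eq, Fin.mk.injEq]; omega)
  have e3 : adjT n j (lo n i) = lo n i := adjT_of_ne _ _
    (by simp only [lo, ne_eq, Fin.mk.injEq]; omega)
    (by simp only [lo, hi, ne_eq, Fin.mk.injEq]; omega)
  have e1 := adjT_lo n i
  have e4 := adjT_hi n i
  have e5 := adjT_lo n j
  have e6 := adjT_hi n j
  rw [e0] at e1 e4 hi'
  have hbr : adjT n i * adjT n j * adjT n i = adjT n j * adjT n i * adjT n j := by
    have : (adjT n i * adjT n j) * adjT n i * (adjT n i * adjT n j)⁻¹ = adjT n j := by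
      have h := Equiv.swap_apply_apply (adjT n i * adjT n j) (lo n i) (hi n i)
      rw [← adjT_eq, e0, Equiv.Perm.mul_apply, Equiv.Perm.mul_apply, e3, e5, e1, e2,
        ← adjT_eq] at h
      exact h.symm
    rw [mul_inv_eq_iff_eq_mul.mp this, mul_assoc]
  obtain ⟨d, hd⟩ := R_exists n _ (w * adjT n i * adjT n j * adjT n i) rfl
  have h1 : R n (w * adjT n i) (d * sg n i * sg n j) := by
    refine R_desc n j ?_ (R_desc n i ?_ hd)
    · simpa only [Equiv.Perm.mul_apply, e1, e2, e3, e4, e5, e6] using hj'.trans hi'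
    · simpa only [Equiv.Perm.mul_apply, e0, e1, e2, e3, e4, e5, e6] using hj'
  have hw : w * adjT n i * adjT n j * adjT n i = w * adjT n j * adjT n i * adjT n j := by
    simpa only [mul_assoc] using congrArg (w * ·) hbr
  rw [hw] at hd
  have h2 : R n (w * adjT n j) (d * sg n j * sg n i) := by
    refine R_desc n i ?_ (R_desc n j ?_ hd)
    · simpa only [Equiv.Perm.mul_apply, e0, e1, e2, e3, e4, e5, e6] using hj'.trans hi'
    · simpa only [Equiv.Perm.mul_apply, e1, e2, e3, e4, e5, e6] using hi'
  have d1 := inv_desc n w i (by rwa [e0])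
  have d2 := inv_desc n w j hj'
  rw [ih _ (by omega) _ _ hc h1, ih _ (by omega) _ _ hc' h2]
  have := sg_braid n i j hij
  simp only [mul_assoc] at this ⊢
  rw [this]

lemma R_unique (n : ℕ) : ∀ (k : ℕ) (w : Equiv.Perm (Fin n)), inv n w = k →
    ∀ b b', R n w b → R n w b' → b = b' := by
  intro k
  induction k using Nat.strong_induction_on with
  | _ k IH =>
  intro w hw b b' hb hb'
  have ih : ∀ w', inv n w' < inv n w → ∀ b b', R n w' b → R n w' b' → b = b' :=
    fun w' h => IH _ (hw ▸ h) w' rfl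
  rcases R_inv n hb with ⟨h1, rfl⟩ | ⟨i, c, hi', hc, rfl⟩
  · rcases R_inv n hb' with ⟨-, rfl⟩ | ⟨j, c', hj', hc', rfl⟩
    · rfl
    · subst h1
      exact absurd hj' (not_lt.mpr (lo_lt_hi n j).le)
  · rcases R_inv n hb' with ⟨h1, rfl⟩ | ⟨j, c', hj', hc', rfl⟩
    · subst h1
      exact absurd hi' (not_lt.mpr (lo_lt_hi n i).le)
    · by_cases hij : i = j
      · subst hij
        have := inv_desc n w i hi'
        rw [ih _ (by omega) _ _ hc hc']
      · have hij' : (i : ℕ) ≠ j := fun h => hij (Fin.ext h)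
        by_cases h1 : (i : ℕ) + 1 = j
        · exact near n w ih i j h1 hi' hj' c c' hc hc'
        · by_cases h2 : (j : ℕ) + 1 = i
          · exact (near n w ih j i h2 hj' hi' c' c hc' hc).symm
          · exact far n w ih i j (by omega) hi' hj' c c' hc hc'

lemma R_of_section (n : ℕ) (s : Equiv.Perm (Fin n) → B n)
    (h1 : ∀ i : Fin (n - 1), s (adjT n i) = PresentedGroup.of i)
    (h2 : ∀ u v : Equiv.Perm (Fin n),
        permLength n (u * v) = permLength n u + permLength n v → s (u * v) = s u * s v)
    {w : Equiv.Perm (Fin n)} {b : B n} (hr : R n w b) : s w = b := by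
  induction hr with
  | one =>
    have := h2 1 1 (by simp [permLength_eq, inv_one])
    rw [one_mul] at this
    exact left_eq_mul.mp this
  | step w b i h hr ih =>
    have h3 : inv n (adjT n i) = 1 := by
      have := inv_asc n 1 i (lo_lt_hi n i)
      rwa [one_mul, inv_one] at this
    rw [h2 w (adjT n i) (by simp only [permLength_eq, h3, inv_asc n w i h]), ih, h1]
    rfl

lemma R_mul (n : ℕ) {u v : Equiv.Perm (Fin n)} {b c : B n} (hb : R n u b) (hc : R n v c)
    (h : inv n (u * v) = inv n u + inv n v) : R n (u * v) (b * c) := by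
  induction hc with
  | one => simpa using hb
  | step v c i hv hr ih =>
    have h1 := inv_asc n v i hv
    rw [← mul_assoc] at h ⊢
    rw [← mul_assoc]
    have h2 := inv_mul_le n (u * v) i
    have h3 := inv_mul_le_add n u v
    refine R.step _ _ i ?_ (ih (by omega))
    rcases asc_or_desc n (u * v) i with h4 | h4
    · exact h4
    · have := inv_desc n (u * v) i h4
      omega

lemma R_proj (n : ℕ) (π : B n →* Equiv.Perm (Fin n))
    (hπ : ∀ i : Fin (n - 1), π (PresentedGroup.of i) = adjT n i)
    {w : Equiv.Perm (Fin n)} {b : B n} (hr : R n w b) : π b = w := by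
  induction hr with
  | one => exact map_one π
  | step w b i h hr ih => rw [map_mul, ih, sg, hπ]

end Matsu

/-- there is a unique function `ŝ : S_n → B_n` with `ŝ(s_i) = σ_i` and
`ŝ(uv) = ŝ(u)ŝ(v)` whenever `ℓ(uv) = ℓ(u) + ℓ(v)`; moreover `ŝ` is a section of the
canonical epimorphism `π : B_n → S_n`. -/
theorem stmt13 (n : ℕ) :
    (∃! s : Equiv.Perm (Fin n) → PresentedGroup (braidRels (n - 1)),
      (∀ i : Fin (n - 1), s (adjT n i) = PresentedGroup.of i) ∧
      (∀ u v : Equiv.Perm (Fin n),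
        permLength n (u * v) = permLength n u + permLength n v → s (u * v) = s u * s v)) ∧
    (∀ s : Equiv.Perm (Fin n) → PresentedGroup (braidRels (n - 1)),
      ((∀ i : Fin (n - 1), s (adjT n i) = PresentedGroup.of i) ∧
       (∀ u v : Equiv.Perm (Fin n),
         permLength n (u * v) = permLength n u + permLength n v → s (u * v) = s u * s v)) →
      ∀ π : PresentedGroup (braidRels (n - 1)) →* Equiv.Perm (Fin n),
        (∀ i : Fin (n - 1), π (PresentedGroup.of i) = adjT n i) →
        ∀ w : Equiv.Perm (Fin n), π (s w) = w) := by
  choose f hf using fun w => Matsu.R_exists n _ w rfl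
  refine ⟨⟨f, ⟨?_, ?_⟩, ?_⟩, ?_⟩
  · intro i
    refine Matsu.R_unique n _ _ rfl _ _ (hf _) ?_
    have := Matsu.R.step 1 1 i (Matsu.lo_lt_hi n i) Matsu.R.one
    rwa [one_mul, one_mul] at this
  · intro u v h
    simp only [Matsu.permLength_eq] at h
    exact Matsu.R_unique n _ _ rfl _ _ (hf _) (Matsu.R_mul n (hf u) (hf v) h)
  · rintro g ⟨h1, h2⟩
    funext w
    exact Matsu.R_of_section n g h1 h2 (hf w)
  · rintro g ⟨h1, h2⟩ π hπ w
    rw [Matsu.R_of_section n g h1 h2 (hf w)]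
    exact Matsu.R_proj n π hπ (hf w)
end
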